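/- (Aubry duality, pointwise form) Let λ > 0, α, ω, ω̃ ∈ ℝ, E ∈ ℝ, and let u : ℤ → ℂ be absolutely summable (u ∈ ℓ¹(ℤ)) and satisfy u(n+1) + u(n−1) + 2λ cos(2π(ω + nα)) u(n) = E u(n) for every n ∈ ℤ. Define û(θ) = Σ_{m ∈ ℤ} u(m) e^{2πimθ} and ũ(n) = û(ω̃ + nα) e^{2πinω}. Then ũ satisfies ũ(n+1) + ũ(n−1) + 2λ^{−1} cos(2π(ω̃ + nα)) ũ(n) = (λ^{−1}E) ũ(n) for every n ∈ ℤ. -/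

import Mathlib

/-- The Fourier series `û(θ) = Σ_{m ∈ ℤ} u(m) e^{2πimθ}` of a sequence `u : ℤ → ℂ`. -/
noncomputable def fourierSeries (u : ℤ → ℂ) (θ : ℝ) : ℂ :=
  ∑' m : ℤ, u m * Complex.exp (2 * Real.pi * Complex.I * m * θ)

theorem norm_exp_two_pi_I_int_mul (m : ℤ) (θ : ℝ) :
    ‖Complex.exp (2 * Real.pi * Complex.I * m * θ)‖ = 1 := by
  rw [show (2 * Real.pi * Complex.I * m * θ : ℂ) = ((2 * Real.pi * m * θ : ℝ) : ℂ) * Complex.I by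
    push_cast; ring]
  exact Complex.norm_exp_ofReal_mul_I _

theorem hasSum_fourierSeries {u : ℤ → ℂ} (hu : Summable fun m : ℤ => ‖u m‖) (θ : ℝ) :
    HasSum (fun m : ℤ => u m * Complex.exp (2 * Real.pi * Complex.I * m * θ))
      (fourierSeries u θ) := by
  refine (Summable.of_norm ?_).hasSum
  simpa only [norm_mul, norm_exp_two_pi_I_int_mul, mul_one] using hu

/-- Translating a sequence by `k` multiplies its Fourier series by `e^{-2πikθ}`. -/
theorem hasSum_fourierSeries_shift {u : ℤ → ℂ} (hu : Summable fun m : ℤ => ‖u m‖) (k : ℤ)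
    (θ : ℝ) :
    HasSum (fun m : ℤ => u (m + k) * Complex.exp (2 * Real.pi * Complex.I * m * θ))
      (Complex.exp (-(2 * Real.pi * Complex.I * k * θ)) * fourierSeries u θ) := by
  have h := ((Equiv.addRight k).hasSum_iff.mpr (hasSum_fourierSeries hu θ)).mul_left
    (Complex.exp (-(2 * Real.pi * Complex.I * k * θ)))
  refine h.congr_fun fun m => ?_
  simp only [Function.comp_apply, Equiv.coe_addRight]
  rw [mul_left_comm, ← Complex.exp_add]
  congr 2
  push_cast
  ring

theorem two_mul_ofReal_cos_two_pi (x : ℝ) :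
    2 * ((Real.cos (2 * Real.pi * x) : ℝ) : ℂ) =
      Complex.exp (2 * Real.pi * Complex.I * x) + Complex.exp (-(2 * Real.pi * Complex.I * x)) := by
  rw [Complex.ofReal_cos, Complex.two_cos]
  push_cast
  congr 2 <;> ring

/-- The almost Mathieu equation on the Fourier side. -/
theorem fourierSeries_almostMathieu {lam α ω E : ℝ} {u : ℤ → ℂ}
    (hu : Summable fun m : ℤ => ‖u m‖)
    (hsol : ∀ n : ℤ,
      u (n + 1) + u (n - 1) +
        (↑(2 * lam * Real.cos (2 * Real.pi * (ω + n * α))) : ℂ) * u n = (E : ℂ) * u n)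
    (θ : ℝ) :
    (↑(2 * Real.cos (2 * Real.pi * θ)) : ℂ) * fourierSeries u θ +
      lam * (Complex.exp (2 * Real.pi * Complex.I * ω) * fourierSeries u (θ + α) +
        Complex.exp (-(2 * Real.pi * Complex.I * ω)) * fourierSeries u (θ - α)) =
      E * fourierSeries u θ := by
  have hsum := ((hasSum_fourierSeries_shift hu 1 θ).add
    (hasSum_fourierSeries_shift hu (-1) θ)).add
    ((((hasSum_fourierSeries hu (θ + α)).mul_left (Complex.exp (2 * Real.pi * Complex.I * ω))).add
      ((hasSum_fourierSeries hu (θ - α)).mul_left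
        (Complex.exp (-(2 * Real.pi * Complex.I * ω))))).mul_left (lam : ℂ))
  have key := (hsum.congr_fun (g := fun m : ℤ =>
    (E : ℂ) * (u m * Complex.exp (2 * Real.pi * Complex.I * m * θ))) fun m => ?_).unique
      ((hasSum_fourierSeries hu θ).mul_left (E : ℂ))
  · rw [← key, Complex.ofReal_mul, Complex.ofReal_ofNat, two_mul_ofReal_cos_two_pi]
    push_cast
    rw [show -(2 * Real.pi * Complex.I * -1 * θ : ℂ) = 2 * Real.pi * Complex.I * θ by ring, mul_one]
    ring
  · have hcos := two_mul_ofReal_cos_two_pi (ω + m * α)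
    have hplus : Complex.exp (2 * Real.pi * Complex.I * m * ↑(θ + α)) *
        Complex.exp (2 * Real.pi * Complex.I * ω) =
        Complex.exp (2 * Real.pi * Complex.I * m * θ) *
          Complex.exp (2 * Real.pi * Complex.I * ↑(ω + m * α)) := by
      rw [← Complex.exp_add, ← Complex.exp_add]
      push_cast
      congr 1
      ring
    have hminus : Complex.exp (2 * Real.pi * Complex.I * m * ↑(θ - α)) *
        Complex.exp (-(2 * Real.pi * Complex.I * ω)) =
        Complex.exp (2 * Real.pi * Complex.I * m * θ) *
          Complex.exp (-(2 * Real.pi * Complex.I * ↑(ω + m * α))) := by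
      rw [← Complex.exp_add, ← Complex.exp_add]
      push_cast
      congr 1
      ring
    have h := hsol m
    rw [Complex.ofReal_mul, Complex.ofReal_mul, Complex.ofReal_ofNat] at h
    rw [← sub_eq_add_neg]
    linear_combination (-Complex.exp (2 * Real.pi * Complex.I * m * θ)) * h +
      (lam * u m * Complex.exp (2 * Real.pi * Complex.I * m * θ)) * hcos
      - lam * u m * hplus - lam * u m * hminus

/-- Aubry duality, pointwise form: if `u ∈ ℓ¹(ℤ)` solves the almost Mathieu difference
equation at coupling `λ`, phase `ω`, and energy `E`, then for any `ω̃` the sequence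
`ũ(n) = û(ω̃ + nα) e^{2πinω}` solves the dual equation at coupling `λ⁻¹` and energy
`λ⁻¹ E`. -/
theorem aubry_duality_pointwise (lam α ω ωt E : ℝ) (hlam : 0 < lam)
    (u : ℤ → ℂ) (hu : Summable fun m : ℤ => ‖u m‖)
    (hsol : ∀ n : ℤ,
      u (n + 1) + u (n - 1) +
        (↑(2 * lam * Real.cos (2 * Real.pi * (ω + n * α))) : ℂ) * u n = (E : ℂ) * u n) :
    ∀ n : ℤ,
      (fun m : ℤ => fourierSeries u (ωt + m * α) * Complex.exp (2 * Real.pi * Complex.I * m * ω))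
          (n + 1) +
        (fun m : ℤ => fourierSeries u (ωt + m * α) * Complex.exp (2 * Real.pi * Complex.I * m * ω))
          (n - 1) +
        (↑(2 * lam⁻¹ * Real.cos (2 * Real.pi * (ωt + n * α))) : ℂ) *
          (fourierSeries u (ωt + n * α) * Complex.exp (2 * Real.pi * Complex.I * n * ω)) =
      (↑(lam⁻¹ * E) : ℂ) *
        (fourierSeries u (ωt + n * α) * Complex.exp (2 * Real.pi * Complex.I * n * ω)) := by
  intro n
  have key := fourierSeries_almostMathieu hu hsol (ωt + n * α)
  have hl : (lam : ℂ) * (lam : ℂ)⁻¹ = 1 := mul_inv_cancel₀ (by exact_mod_cast hlam.ne')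
  have hsucc : Complex.exp (2 * Real.pi * Complex.I * ↑(n + 1) * ω) =
      Complex.exp (2 * Real.pi * Complex.I * n * ω) *
        Complex.exp (2 * Real.pi * Complex.I * ω) := by
    rw [← Complex.exp_add]
    push_cast
    congr 1
    ring
  have hpred : Complex.exp (2 * Real.pi * Complex.I * ↑(n - 1) * ω) =
      Complex.exp (2 * Real.pi * Complex.I * n * ω) *
        Complex.exp (-(2 * Real.pi * Complex.I * ω)) := by
    rw [← Complex.exp_add]
    push_cast
    congr 1
    ring
  have hθsucc : ωt + ((n + 1 : ℤ) : ℝ) * α = ωt + n * α + α := by push_cast; ring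
  have hθpred : ωt + ((n - 1 : ℤ) : ℝ) * α = ωt + n * α - α := by push_cast; ring
  beta_reduce
  rw [hsucc, hpred, hθsucc, hθpred]
  simp only [Complex.ofReal_mul, Complex.ofReal_inv, Complex.ofReal_ofNat] at key ⊢
  linear_combination ((lam : ℂ)⁻¹ * Complex.exp (2 * Real.pi * Complex.I * n * ω)) * key -
    (Complex.exp (2 * Real.pi * Complex.I * n * ω) *
      (Complex.exp (2 * Real.pi * Complex.I * ω) * fourierSeries u (ωt + n * α + α) +
        Complex.exp (-(2 * Real.pi * Complex.I * ω)) * fourierSeries u (ωt + n * α - α))) * hl
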